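/- Let (X,d) be a totally split-decomposable metric space with integer-valued metric satisfying the local rank condition. Then E(X,d) is cell-decomposable: for every f ∈ E(X,d), the cell [f] := {g ∈ Δ(X,d) : A(f) ⊆ A(g)} is X-gated with respect to the canonical embedding e: x ↦ d_x = d(x,·) and the metric d_∞, i.e. for every x ∈ X there exists g_x ∈ [f] such that d_∞(d_x, h) = d_∞(d_x, g_x) + d_∞(g_x, h) for all h ∈ [f]. -/

import Mathlib

open Set Function

noncomputable section

variable {X : Type*}

/-- `d` is a pseudometric on `X`. -/
def IsPseudometric (d : X → X → ℝ) : Prop :=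
  (∀ x, d x x = 0) ∧ (∀ x y, d x y = d y x) ∧ ∀ x y z, d x z ≤ d x y + d y z

/-- `d` is a metric on `X`. -/
def IsMetric (d : X → X → ℝ) : Prop :=
  IsPseudometric d ∧ ∀ x y, d x y = 0 → x = y

/-- `d` is integer-valued. -/
def IsIntegerValued (d : X → X → ℝ) : Prop := ∀ x y, ∃ n : ℤ, d x y = (n : ℝ)

/-- The quantity `β^d` associated to the four points `a, a', b, b'`. -/
def betaIdx (d : X → X → ℝ) (a a' b b' : X) : ℝ :=
  (max (max (d a b + d a' b') (d a' b + d a b')) (d a a' + d b b') - d a a' - d b b') / 2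

/-- The isolation index `α^d_{{A,B}}` of the pair `{A,B}`. -/
def isolIdx (d : X → X → ℝ) (A B : Set X) : ℝ :=
  sInf {r : ℝ | ∃ a ∈ A, ∃ a' ∈ A, ∃ b ∈ B, ∃ b' ∈ B, r = betaIdx d a a' b b'}

/-- `{A, B}` is a partial split of `X`. -/
def IsPartialSplit (A B : Set X) : Prop := A.Nonempty ∧ B.Nonempty ∧ Disjoint A B

/-- `{A, B}` is a split of `X`. -/
def IsSplit (A B : Set X) : Prop := IsPartialSplit A B ∧ A ∪ B = univ

/-- `{A, B}` is a `d`-split of `X`. -/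
def IsDSplit (d : X → X → ℝ) (A B : Set X) : Prop := IsSplit A B ∧ 0 < isolIdx d A B

open Classical in
/-- The split pseudometric `δ_S` of the split `{A, Aᶜ}`. -/
def splitDist (A : Set X) (x y : X) : ℝ := if x ∈ A ↔ y ∈ A then 0 else 1

/-- `Δ(X, ρ)`: functions with `f x + f y ≥ ρ x y` for all `x, y`. -/
def DeltaSet (ρ : X → X → ℝ) : Set (X → ℝ) := {f | ∀ x y, ρ x y ≤ f x + f y}

/-- Isbell's injective hull `E(X, d)`: the extremal functions, i.e. those with
`f x = sup_y (d x y - f y)` for every `x`. -/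
def ExtSet (d : X → X → ℝ) : Set (X → ℝ) :=
  {f | ∀ x, IsLUB {r : ℝ | ∃ y, r = d x y - f y} (f x)}

/-- `E'(X, d)`: elements of `Δ(X, d)` such that every point lies in some pair of `A(f)`. -/
def ExtSet' (d : X → X → ℝ) : Set (X → ℝ) :=
  {f | f ∈ DeltaSet d ∧ ∀ x, ∃ y, f x + f y = d x y}

/-- The set `A(f)` of (ordered) pairs where equality holds. -/
def eqSet (d : X → X → ℝ) (f : X → ℝ) : Set (X × X) := {p | f p.1 + f p.2 = d p.1 p.2}

/-- The direction space of the affine subspace `H(A)`; its dimension is `rank A`. -/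
def dirSubmodule (A : Set (X × X)) : Submodule ℝ (X → ℝ) where
  carrier := {h | ∀ p ∈ A, h p.1 + h p.2 = 0}
  add_mem' := by
    intro a b ha hb p hp
    have h1 := ha p hp
    have h2 := hb p hp
    simp only [Pi.add_apply]
    linarith
  zero_mem' := by intro p _; simp
  smul_mem' := by
    intro c a ha p hp
    have h1 := ha p hp
    simp only [Pi.smul_apply, smul_eq_mul]
    linear_combination c * h1

/-- The local rank condition. -/
def LRC (d : X → X → ℝ) : Prop :=
  ∀ f ∈ ExtSet d, ∃ ε : ℝ, 0 < ε ∧ ∃ N : ℕ,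
    ∀ g ∈ ExtSet' d, (∀ x, |f x - g x| < ε) →
      Module.rank ℝ (dirSubmodule (eqSet d g)) ≤ (N : Cardinal)

/-- `d` is totally split-decomposable: `d = ∑_{S a d-split} α_S δ_S`, where each
separating `d`-split `{A, Aᶜ}` is counted once via its part `A` containing `x`. -/
def TSD (d : X → X → ℝ) : Prop :=
  ∀ x y, d x y = ∑ᶠ A ∈ {A : Set X | IsDSplit d A Aᶜ ∧ x ∈ A ∧ y ∉ A}, isolIdx d A Aᶜ

/-- The cell `[f]` of `f ∈ E(X,d)`: all `g ∈ Δ(X,d)` with `A(f) ⊆ A(g)`. -/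
def cellOf (d : X → X → ℝ) (f : X → ℝ) : Set (X → ℝ) :=
  {g | g ∈ DeltaSet d ∧ ∀ x y, f x + f y = d x y → g x + g y = d x y}

open scoped ENNReal

/-- The sup-distance `d_∞(f, g) = sup_i |f i - g i|`, valued in `[0,∞]`. -/
def supDist {ι : Type*} (f g : ι → ℝ) : ℝ≥0∞ := ⨆ i, edist (f i) (g i)

/-! ### Isolation indices and weak compatibility -/

theorem betaIdx_nonneg (d : X → X → ℝ) (a a' b b' : X) : 0 ≤ betaIdx d a a' b b' := by
  have := le_max_right (max (d a b + d a' b') (d a' b + d a b')) (d a a' + d b b')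
  unfold betaIdx
  linarith

theorem isolIdx_le_betaIdx (d : X → X → ℝ) {A B : Set X} {a a' b b' : X}
    (ha : a ∈ A) (ha' : a' ∈ A) (hb : b ∈ B) (hb' : b' ∈ B) :
    isolIdx d A B ≤ betaIdx d a a' b b' := by
  refine csInf_le ⟨0, ?_⟩ ⟨a, ha, a', ha', b, hb, b', hb', rfl⟩
  rintro _ ⟨a, _, a', _, b, _, b', _, rfl⟩
  exact betaIdx_nonneg d a a' b b'

theorem betaIdx_swap {d : X → X → ℝ} (hsymm : ∀ x y, d x y = d y x) (a a' b b' : X) :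
    betaIdx d b b' a a' = betaIdx d a a' b b' := by
  unfold betaIdx
  rw [hsymm b a, hsymm b' a', hsymm b' a, hsymm b a', add_comm (d a b') (d a' b),
    add_comm (d b b') (d a a')]
  ring

theorem isolIdx_swap {d : X → X → ℝ} (hsymm : ∀ x y, d x y = d y x) (A B : Set X) :
    isolIdx d B A = isolIdx d A B := by
  unfold isolIdx
  congr 1
  ext r
  constructor
  · rintro ⟨b, hb, b', hb', a, ha, a', ha', rfl⟩
    exact ⟨a, ha, a', ha', b, hb, b', hb', betaIdx_swap hsymm a a' b b'⟩
  · rintro ⟨a, ha, a', ha', b, hb, b', hb', rfl⟩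
    exact ⟨b, hb, b', hb', a, ha, a', ha', (betaIdx_swap hsymm a a' b b').symm⟩

theorem IsDSplit.compl {d : X → X → ℝ} (hsymm : ∀ x y, d x y = d y x) {A : Set X}
    (hA : IsDSplit d A Aᶜ) : IsDSplit d Aᶜ Aᶜᶜ := by
  obtain ⟨⟨⟨h1, h2, h3⟩, h4⟩, h5⟩ := hA
  rw [compl_compl]
  exact ⟨⟨⟨h2, h1, h3.symm⟩, by rw [union_comm, h4]⟩, by rwa [isolIdx_swap hsymm]⟩

/-- `A` separates `{p, q}` from `{r, s}`. -/
def SeparatesPairs (A : Set X) (p q r s : X) : Prop :=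
  (p ∈ A ↔ q ∈ A) ∧ (r ∈ A ↔ s ∈ A) ∧ ¬(p ∈ A ↔ r ∈ A)

theorem IsDSplit.add_lt_max {d : X → X → ℝ} (hsymm : ∀ x y, d x y = d y x) {A : Set X}
    (hA : IsDSplit d A Aᶜ) {p q r s : X} (h : SeparatesPairs A p q r s) :
    d p q + d r s < max (d p r + d q s) (d q r + d p s) := by
  have key : 0 < betaIdx d p q r s := by
    obtain ⟨hpq, hrs, hpr⟩ := h
    by_cases hp : p ∈ A
    · have hr : r ∉ A := by tauto
      exact hA.2.trans_le (isolIdx_le_betaIdx d hp (hpq.1 hp) hr (mt hrs.2 hr))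
    · have hr : r ∈ A := by tauto
      rw [← betaIdx_swap hsymm]
      exact hA.2.trans_le (isolIdx_le_betaIdx d hr (hrs.1 hr) hp (mt hpq.2 hp))
  unfold betaIdx at key
  rcases le_total (d p q + d r s) (max (d p r + d q s) (d q r + d p s)) with h' | h'
  · rw [max_eq_left h'] at key
    linarith
  · rw [max_eq_right h'] at key
    linarith

/-- The family of `d`-splits is weakly compatible. -/
theorem IsDSplit.weakly_compatible {d : X → X → ℝ} (hsymm : ∀ x y, d x y = d y x)
    {A B C : Set X} (hA : IsDSplit d A Aᶜ) (hB : IsDSplit d B Bᶜ) (hC : IsDSplit d C Cᶜ)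
    {p q r s : X} (h1 : SeparatesPairs A p q r s) (h2 : SeparatesPairs B p r q s) :
    ¬SeparatesPairs C p s q r := by
  intro h3
  have e1 := hA.add_lt_max hsymm h1
  have e2 := hB.add_lt_max hsymm h2
  have e3 := hC.add_lt_max hsymm h3
  rw [hsymm r q] at e2
  rw [hsymm s r, hsymm s q] at e3
  rw [lt_max_iff] at e1 e2 e3
  rcases e1 with e1 | e1 <;> rcases e2 with e2 | e2 <;> rcases e3 with e3 | e3 <;> linarith

/-! ### The family of `d`-splits, oriented by a base point -/

/-- The `d`-splits of `X`, each represented by its part containing `x`. -/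
abbrev PointedSplit (d : X → X → ℝ) (x : X) : Type _ :=
  {A : Set X // IsDSplit d A Aᶜ ∧ x ∈ A}

/-- The isolation index of a pointed `d`-split. -/
def PointedSplit.weight {d : X → X → ℝ} {x : X} (A : PointedSplit d x) : ℝ :=
  isolIdx d A.1 A.1ᶜ

theorem PointedSplit.weight_pos {d : X → X → ℝ} {x : X} (A : PointedSplit d x) :
    0 < A.weight := A.2.1.2

theorem splitDist_nonneg (A : Set X) (u v : X) : 0 ≤ splitDist A u v := by
  unfold splitDist
  split_ifs <;> norm_num

theorem splitDist_comm (A : Set X) (u v : X) : splitDist A u v = splitDist A v u := by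
  by_cases hu : u ∈ A <;> by_cases hv : v ∈ A <;> simp [splitDist, hu, hv]

theorem TSD.hasSum {d : X → X → ℝ} (hmet : IsMetric d) (hTSD : TSD d) (x u v : X) :
    HasSum (fun A : PointedSplit d x => A.weight * splitDist A.1 u v) (d u v) := by
  classical
  obtain ⟨⟨hself, hsymm, -⟩, hsep⟩ := hmet
  rcases eq_or_ne u v with rfl | huv
  · simp [splitDist, hself, hasSum_zero]
  set T : Set (Set X) := {A | IsDSplit d A Aᶜ ∧ u ∈ A ∧ v ∉ A}
  have hd : d u v = ∑ᶠ A ∈ T, isolIdx d A Aᶜ := hTSD u v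
  have hfin : T.Finite := by
    by_contra hinf
    refine huv (hsep u v (hd.trans (finsum_mem_eq_zero_of_infinite ?_)))
    have hsub : T ⊆ support fun A => isolIdx d A Aᶜ := fun A hA => hA.1.2.ne'
    rwa [inter_eq_left.2 hsub]
  have : Fintype T := hfin.fintype
  have hsum : HasSum (fun A : T => isolIdx d A.1 A.1ᶜ) (d u v) := by
    rw [hd, finsum_mem_eq_sum_of_inter_support_eq (t := T.toFinset) _ (by simp),
      Finset.sum_subtype (p := (· ∈ T)) T.toFinset (by simp) fun A => isolIdx d A Aᶜ]
    exact hasSum_fintype _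
  let j : T → PointedSplit d x := fun A =>
    if h : x ∈ A.1 then ⟨A.1, A.2.1, h⟩ else ⟨A.1ᶜ, A.2.1.compl hsymm, h⟩
  have hj : ∀ A : T, (j A).1 = A.1 ∨ (j A).1 = A.1ᶜ := by
    intro A
    by_cases h : x ∈ A.1 <;> simp [j, h]
  have hinj : Injective j := by
    intro A B hAB
    have hA := A.2.2.1
    have hB := B.2.2.1
    have hval := congrArg Subtype.val hAB
    apply Subtype.ext
    rcases hj A with h1 | h1 <;> rcases hj B with h2 | h2 <;> rw [h1, h2] at hval
    · exact hval
    · rw [hval] at hA; exact absurd hB hA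
    · rw [← hval] at hB; exact absurd hA hB
    · exact compl_injective hval
  refine (hinj.hasSum_iff ?_).1 ?_
  · intro A hA
    have : splitDist A.1 u v = 0 := by
      by_contra hne
      have hne' : ¬(u ∈ A.1 ↔ v ∈ A.1) := fun h => hne (if_pos h)
      by_cases hu : u ∈ A.1
      · exact hA ⟨⟨A.1, A.2.1, hu, by tauto⟩, by simp [j, A.2.2]⟩
      · refine hA ⟨⟨A.1ᶜ, A.2.1.compl hsymm, hu, ?_⟩, ?_⟩
        · exact fun h => h (by tauto)
        · simp [j, A.2.2]
    rw [this, mul_zero]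
  · convert hsum using 1
    funext A
    have hu := A.2.2.1
    have hv := A.2.2.2
    rcases hj A with h | h <;> simp [PointedSplit.weight, h, splitDist, hu, hv, isolIdx_swap hsymm]

/-! ### Decomposing functions along splits -/

open Classical in
/-- The function on `X` with value `t` on `A` and `w - t` on the complement of `A`. -/
def splitPart (A : Set X) (w t : ℝ) (u : X) : ℝ := if u ∈ A then t else w - t

/-- The excess of `splitPart A w t` over `w • splitDist A`. -/
def splitExcess (A : Set X) (w t : ℝ) (u v : X) : ℝ :=
  splitPart A w t u + splitPart A w t v - w * splitDist A u v

theorem splitExcess_of_mem {A : Set X} {u v : X} (w t : ℝ) (hu : u ∈ A) (hv : v ∈ A) :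
    splitExcess A w t u v = 2 * t := by
  simp [splitExcess, splitPart, splitDist, hu, hv, two_mul]

theorem splitExcess_of_notMem {A : Set X} {u v : X} (w t : ℝ) (hu : u ∉ A) (hv : v ∉ A) :
    splitExcess A w t u v = 2 * (w - t) := by
  simp [splitExcess, splitPart, splitDist, hu, hv, two_mul]

theorem splitExcess_of_not_iff {A : Set X} {u v : X} (w t : ℝ) (h : ¬(u ∈ A ↔ v ∈ A)) :
    splitExcess A w t u v = 0 := by
  by_cases hu : u ∈ A <;> by_cases hv : v ∈ A <;>
    simp_all [splitExcess, splitPart, splitDist]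

theorem splitPart_nonneg {A : Set X} {w t : ℝ} (ht : t ∈ Icc 0 w) (u : X) :
    0 ≤ splitPart A w t u := by
  unfold splitPart
  split_ifs
  exacts [ht.1, sub_nonneg.2 ht.2]

theorem splitExcess_nonneg {A : Set X} {w t : ℝ} (ht : t ∈ Icc 0 w) (u v : X) :
    0 ≤ splitExcess A w t u v := by
  by_cases h : u ∈ A ↔ v ∈ A
  · by_cases hu : u ∈ A
    · rw [splitExcess_of_mem w t hu (h.1 hu)]
      linarith [ht.1]
    · rw [splitExcess_of_notMem w t hu (mt h.2 hu)]
      linarith [ht.2]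
  · rw [splitExcess_of_not_iff w t h]

theorem continuous_splitExcess (A : Set X) (w : ℝ) (u v : X) :
    Continuous fun t => splitExcess A w t u v := by
  unfold splitExcess splitPart
  split_ifs <;> fun_prop

theorem splitDist_quartet_le {B : Set X} {p q r s : X} (h : ¬SeparatesPairs B p s q r) :
    splitDist B p q + splitDist B r s ≤ splitDist B p s + splitDist B q r := by
  unfold SeparatesPairs at h
  unfold splitDist
  by_cases hp : p ∈ B <;> by_cases hq : q ∈ B <;> by_cases hr : r ∈ B <;> by_cases hs : s ∈ B <;>
    simp [hp, hq, hr, hs] at h ⊢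

theorem splitDist_quartet_of_separatesPairs {B : Set X} {p q r s : X}
    (h : SeparatesPairs B p q r s) :
    splitDist B p s + splitDist B q r - splitDist B p q - splitDist B r s = 2 := by
  unfold SeparatesPairs at h
  unfold splitDist
  by_cases hp : p ∈ B <;> by_cases hq : q ∈ B <;> by_cases hr : r ∈ B <;> by_cases hs : s ∈ B <;>
    simp [hp, hq, hr, hs] at h ⊢ <;> norm_num

section Decomposition

variable {d : X → X → ℝ} {x : X}

theorem quartet_residual_of_forall_not
    (hsum : ∀ u v, HasSum (fun A : PointedSplit d x => A.weight * splitDist A.1 u v) (d u v))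
    {h : X → ℝ} {t : PointedSplit d x → ℝ} {F : Finset (PointedSplit d x)}
    (hF : ∀ u v, ∑ A ∈ F, splitExcess A.1 A.weight (t A) u v ≤ h u + h v - d u v)
    {A : PointedSplit d x} (hA : A ∉ F) {p q r s : X} (hsep : SeparatesPairs A.1 p q r s)
    (hno : ∀ B : PointedSplit d x, ¬SeparatesPairs B.1 p s q r) :
    2 * A.weight ≤
      (h p + h q - d p q - ∑ A ∈ F, splitExcess A.1 A.weight (t A) p q) +
      (h r + h s - d r s - ∑ A ∈ F, splitExcess A.1 A.weight (t A) r s) := by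
  classical
  let K : PointedSplit d x → ℝ := fun B =>
    B.weight * splitDist B.1 p s + B.weight * splitDist B.1 q r
      - B.weight * splitDist B.1 p q - B.weight * splitDist B.1 r s
  have hK : HasSum K (d p s + d q r - d p q - d r s) :=
    (((hsum p s).add (hsum q r)).sub (hsum p q)).sub (hsum r s)
  have hK0 : ∀ B, 0 ≤ K B := by
    intro B
    have := mul_le_mul_of_nonneg_left (splitDist_quartet_le (hno B)) B.weight_pos.le
    simp only [K]
    linarith
  have hle := sum_le_hasSum (insert A F) (fun B _ => hK0 B) hK
  have hKA : K A = 2 * A.weight := by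
    have := splitDist_quartet_of_separatesPairs hsep
    simp only [K]
    linear_combination A.weight * this
  have hKF : ∑ B ∈ F, K B =
      ∑ B ∈ F, splitExcess B.1 B.weight (t B) p q + ∑ B ∈ F, splitExcess B.1 B.weight (t B) r s
      - ∑ B ∈ F, splitExcess B.1 B.weight (t B) p s
      - ∑ B ∈ F, splitExcess B.1 B.weight (t B) q r := by
    rw [← Finset.sum_add_distrib, ← Finset.sum_sub_distrib, ← Finset.sum_sub_distrib]
    refine Finset.sum_congr rfl fun B _ => ?_
    simp only [K, splitExcess]
    ring
  rw [Finset.sum_insert hA, hKA, hKF] at hle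
  linarith [hF p s, hF q r]

theorem quartet_residual (hsymm : ∀ u v, d u v = d v u)
    (hsum : ∀ u v, HasSum (fun A : PointedSplit d x => A.weight * splitDist A.1 u v) (d u v))
    {h : X → ℝ} {t : PointedSplit d x → ℝ} {F : Finset (PointedSplit d x)}
    (hF : ∀ u v, ∑ A ∈ F, splitExcess A.1 A.weight (t A) u v ≤ h u + h v - d u v)
    {A : PointedSplit d x} (hA : A ∉ F) {p q r s : X} (hsep : SeparatesPairs A.1 p q r s) :
    2 * A.weight ≤
      (h p + h q - d p q - ∑ A ∈ F, splitExcess A.1 A.weight (t A) p q) +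
      (h r + h s - d r s - ∑ A ∈ F, splitExcess A.1 A.weight (t A) r s) := by
  by_cases hno : ∀ B : PointedSplit d x, ¬SeparatesPairs B.1 p s q r
  · exact quartet_residual_of_forall_not hsum hF hA hsep hno
  · push Not at hno
    obtain ⟨C, hC⟩ := hno
    have hno' : ∀ B : PointedSplit d x, ¬SeparatesPairs B.1 p r q s := fun B hB =>
      A.2.1.weakly_compatible hsymm B.2.1 C.2.1 hsep hB hC
    have hsep' : SeparatesPairs A.1 p q s r :=
      ⟨hsep.1, hsep.2.1.symm, fun h => hsep.2.2 (h.trans hsep.2.1.symm)⟩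
    have key := quartet_residual_of_forall_not hsum hF hA hsep' hno'
    have hcomm : ∑ A ∈ F, splitExcess A.1 A.weight (t A) s r =
        ∑ A ∈ F, splitExcess A.1 A.weight (t A) r s := by
      refine Finset.sum_congr rfl fun B _ => ?_
      simp only [splitExcess, splitDist_comm B.1 s r]
      ring
    rw [hcomm, hsymm s r] at key
    linarith

theorem exists_finite_decomposition (hsymm : ∀ u v, d u v = d v u)
    (hsum : ∀ u v, HasSum (fun A : PointedSplit d x => A.weight * splitDist A.1 u v) (d u v))
    {h : X → ℝ} (hh : h ∈ DeltaSet d) (F : Finset (PointedSplit d x)) :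
    ∃ t : PointedSplit d x → ℝ, (∀ A, t A ∈ Icc 0 A.weight) ∧
      ∀ u v, ∑ A ∈ F, splitExcess A.1 A.weight (t A) u v ≤ h u + h v - d u v := by
  classical
  induction F using Finset.induction_on with
  | empty =>
    exact ⟨fun _ => 0, fun A => ⟨le_rfl, A.weight_pos.le⟩, fun u v => by
      simpa using hh u v⟩
  | insert A F hA ih =>
    obtain ⟨t, ht, hF⟩ := ih
    set r : X → X → ℝ := fun u v =>
      h u + h v - d u v - ∑ A ∈ F, splitExcess A.1 A.weight (t A) u v with hr
    have hr0 : ∀ u v, 0 ≤ r u v := fun u v => sub_nonneg.2 (hF u v)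
    let R : Set ℝ := {y | ∃ p ∈ A.1, ∃ q ∈ A.1, y = r p q / 2}
    have hRlb : ∀ y ∈ R, 0 ≤ y := by
      rintro _ ⟨p, _, q, _, rfl⟩
      exact div_nonneg (hr0 p q) zero_le_two
    have hRne : R.Nonempty := ⟨_, x, A.2.2, x, A.2.2, rfl⟩
    have hinf : 0 ≤ sInf R := le_csInf hRne hRlb
    set τ := min A.weight (sInf R) with hτ
    refine ⟨Function.update t A τ, fun B => ?_, fun u v => ?_⟩
    · by_cases hB : B = A
      · subst hB
        simpa [hτ] using ⟨B.weight_pos.le, hinf⟩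
      · simpa [hB] using ht B
    · have hcongr : ∑ B ∈ F, splitExcess B.1 B.weight (Function.update t A τ B) u v =
          ∑ B ∈ F, splitExcess B.1 B.weight (t B) u v :=
        Finset.sum_congr rfl fun B hB => by
          rw [Function.update_of_ne (ne_of_mem_of_not_mem hB hA)]
      rw [Finset.sum_insert hA, hcongr, Function.update_self]
      suffices splitExcess A.1 A.weight τ u v ≤ r u v by
        simp only [hr] at this
        linarith
      by_cases huv : u ∈ A.1 ↔ v ∈ A.1
      · by_cases hu : u ∈ A.1
        · rw [splitExcess_of_mem _ _ hu (huv.1 hu)]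
          have : τ ≤ r u v / 2 := (min_le_right _ _).trans
            (csInf_le ⟨0, hRlb⟩ ⟨u, hu, v, huv.1 hu, rfl⟩)
          linarith
        · have hv := mt huv.2 hu
          rw [splitExcess_of_notMem _ _ hu hv]
          have : A.weight - r u v / 2 ≤ τ := by
            refine le_min (by linarith [hr0 u v]) (le_csInf hRne ?_)
            rintro _ ⟨p, hp, q, hq, rfl⟩
            have := quartet_residual hsymm hsum hF hA (p := p) (q := q) (r := u) (s := v)
              ⟨iff_of_true hp hq, huv, fun h => hu (h.1 hp)⟩
            simp only [hr]
            linarith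
          linarith
      · rw [splitExcess_of_not_iff _ _ huv]
        exact hr0 u v

/-- Every element of `Δ(X, d)` dominates a sum of elements of the `Δ(X, α_S δ_S)`. -/
theorem exists_decomposition (hsymm : ∀ u v, d u v = d v u)
    (hsum : ∀ u v, HasSum (fun A : PointedSplit d x => A.weight * splitDist A.1 u v) (d u v))
    {h : X → ℝ} (hh : h ∈ DeltaSet d) :
    ∃ t : PointedSplit d x → ℝ, (∀ A, t A ∈ Icc 0 A.weight) ∧
      ∀ (F : Finset (PointedSplit d x)) (u v),
        ∑ A ∈ F, splitExcess A.1 A.weight (t A) u v ≤ h u + h v - d u v := by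
  classical
  let box : Set (PointedSplit d x → ℝ) := univ.pi fun A => Icc 0 A.weight
  let K : Finset (PointedSplit d x) → Set (PointedSplit d x → ℝ) := fun F =>
    box ∩ {t | ∀ u v, ∑ A ∈ F, splitExcess A.1 A.weight (t A) u v ≤ h u + h v - d u v}
  have hbox : IsCompact box := isCompact_univ_pi fun _ => isCompact_Icc
  have hclosed : ∀ F, IsClosed (K F) := by
    intro F
    refine hbox.isClosed.inter ?_
    simp only [ofPred_forall]
    refine isClosed_iInter fun u => isClosed_iInter fun v => isClosed_le ?_ continuous_const
    exact continuous_finsetSum _ fun A _ =>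
      (continuous_splitExcess A.1 A.weight u v).comp (continuous_apply A)
  have hmono : ∀ {F G : Finset (PointedSplit d x)}, F ⊆ G → K G ⊆ K F := by
    rintro F G hFG t ⟨ht, hG⟩
    refine ⟨ht, fun u v => (Finset.sum_le_sum_of_subset_of_nonneg hFG fun A _ _ => ?_).trans
      (hG u v)⟩
    exact splitExcess_nonneg (ht A (mem_univ A)) u v
  obtain ⟨t, ht⟩ := IsCompact.nonempty_iInter_of_directed_nonempty_isCompact_isClosed K
    (fun F G => ⟨F ∪ G, hmono Finset.subset_union_left, hmono Finset.subset_union_right⟩)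
    (fun F => by
      obtain ⟨t, ht, hF⟩ := exists_finite_decomposition hsymm hsum hh F
      exact ⟨t, fun A _ => ht A, hF⟩)
    (fun F => hbox.of_isClosed_subset (hclosed F) inter_subset_left) hclosed
  rw [mem_iInter] at ht
  exact ⟨t, fun A => (ht ∅).1 A (mem_univ A), fun F => (ht F).2⟩

/-- Every element of `E'(X, d)` is a sum of elements of the `Δ(X, α_S δ_S)`, whose pairs of
equality contain those of the sum. -/
theorem exists_hasSum_splitPart (hself : ∀ u, d u u = 0) (hsymm : ∀ u v, d u v = d v u)
    (hsum : ∀ u v, HasSum (fun A : PointedSplit d x => A.weight * splitDist A.1 u v) (d u v))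
    {h : X → ℝ} (hh : h ∈ ExtSet' d) :
    ∃ t : PointedSplit d x → ℝ, (∀ A, t A ∈ Icc 0 A.weight) ∧
      (∀ u, HasSum (fun A : PointedSplit d x => splitPart A.1 A.weight (t A) u) (h u)) ∧
      ∀ A u v, h u + h v = d u v → splitExcess A.1 A.weight (t A) u v = 0 := by
  obtain ⟨t, ht, hF⟩ := exists_decomposition hsymm hsum hh.1
  have hnn : ∀ u (A : PointedSplit d x), 0 ≤ splitPart A.1 A.weight (t A) u :=
    fun u A => splitPart_nonneg (ht A) u
  have hbound : ∀ u (F : Finset (PointedSplit d x)),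
      ∑ A ∈ F, splitPart A.1 A.weight (t A) u ≤ h u := by
    intro u F
    have h1 := hF F u u
    have h2 : ∑ A ∈ F, splitExcess A.1 A.weight (t A) u u =
        2 * ∑ A ∈ F, splitPart A.1 A.weight (t A) u := by
      rw [Finset.mul_sum]
      refine Finset.sum_congr rfl fun A _ => ?_
      simp [splitExcess, splitDist, two_mul]
    rw [h2, hself] at h1
    linarith
  have hsummable : ∀ u, Summable fun A : PointedSplit d x => splitPart A.1 A.weight (t A) u :=
    fun u => summable_of_sum_le (hnn u) (hbound u)
  refine ⟨t, ht, fun u => ?_, fun A u v huv => ?_⟩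
  · have hle : ∀ u, ∑' A : PointedSplit d x, splitPart A.1 A.weight (t A) u ≤ h u :=
      fun u => (hsummable u).tsum_le_of_sum_le (hbound u)
    obtain ⟨v, huv⟩ := hh.2 u
    have h1 : d u v ≤ ∑' A : PointedSplit d x, splitPart A.1 A.weight (t A) u +
        ∑' A : PointedSplit d x, splitPart A.1 A.weight (t A) v :=
      hasSum_le (fun A => sub_nonneg.1 (splitExcess_nonneg (ht A) u v)) (hsum u v)
        ((hsummable u).hasSum.add (hsummable v).hasSum)
    have h2 : ∑' A : PointedSplit d x, splitPart A.1 A.weight (t A) u = h u :=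
      le_antisymm (hle u) (by linarith [hle v])
    exact h2 ▸ (hsummable u).hasSum
  · have := hF {A} u v
    rw [Finset.sum_singleton] at this
    exact le_antisymm (by linarith) (splitExcess_nonneg (ht A) u v)

/-- The minimum of the `x`-coordinate on the cell of `f ∈ E'(X, d)` controls the distance to all
elements of the cell. -/
theorem exists_gate (hself : ∀ u, d u u = 0) (hsymm : ∀ u v, d u v = d v u)
    (hsum : ∀ u v, HasSum (fun A : PointedSplit d x => A.weight * splitDist A.1 u v) (d u v))
    {f : X → ℝ} (hf : f ∈ ExtSet' d) :
    ∃ g ∈ cellOf d f, ∀ h ∈ cellOf d f, ∀ y, |g y - h y| ≤ h x - g x := by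
  classical
  obtain ⟨t, ht, hfsum, hedge⟩ := exists_hasSum_splitPart hself hsymm hsum hf
  let free : PointedSplit d x → Prop := fun A =>
    ∀ u v, f u + f v = d u v → ¬(u ∈ A.1 ↔ v ∈ A.1)
  let τ : PointedSplit d x → ℝ := fun A => if free A then 0 else t A
  have hτ : ∀ A, τ A ∈ Icc 0 A.weight := by
    intro A
    by_cases hA : free A
    · simpa [τ, hA] using A.weight_pos.le
    · simpa [τ, hA] using ht A
  have hsummable : ∀ u, Summable fun A : PointedSplit d x => splitPart A.1 A.weight (τ A) u := by
    intro u
    refine Summable.of_nonneg_of_le (fun A => splitPart_nonneg (hτ A) u) (fun A => ?_)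
      ((hsum x u).summable.add (hfsum u).summable)
    have h1 := splitPart_nonneg (A := A.1) (ht A) u
    have h2 := mul_nonneg A.weight_pos.le (splitDist_nonneg A.1 x u)
    by_cases hA : free A
    · have : splitPart A.1 A.weight (τ A) u = A.weight * splitDist A.1 x u := by
        by_cases hu : u ∈ A.1 <;> simp [τ, hA, splitPart, splitDist, hu, A.2.2]
      linarith
    · simp only [τ, if_neg hA]
      linarith
  let g : X → ℝ := fun u => ∑' A : PointedSplit d x, splitPart A.1 A.weight (τ A) u
  have hg : ∀ u, HasSum (fun A : PointedSplit d x => splitPart A.1 A.weight (τ A) u) (g u) :=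
    fun u => (hsummable u).hasSum
  have hexc : ∀ u v, HasSum (fun A : PointedSplit d x => splitExcess A.1 A.weight (τ A) u v)
      (g u + g v - d u v) := fun u v => ((hg u).add (hg v)).sub (hsum u v)
  refine ⟨g, ⟨fun u v => sub_nonneg.1 ((hexc u v).nonneg fun A =>
    splitExcess_nonneg (hτ A) u v), fun u v huv => ?_⟩, ?_⟩
  · have hz : (fun A : PointedSplit d x => splitExcess A.1 A.weight (τ A) u v) = fun _ => 0 := by
      funext A
      by_cases hA : free A
      · exact splitExcess_of_not_iff _ _ (hA u v huv)
      · simpa only [τ, if_neg hA] using hedge A u v huv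
    have := hexc u v
    rw [hz] at this
    linarith [this.unique hasSum_zero]
  · intro h hh y
    have hh' : h ∈ ExtSet' d := ⟨hh.1, fun u => (hf.2 u).imp fun v huv => hh.2 u v huv⟩
    obtain ⟨s, hs, hhsum, hedge'⟩ := exists_hasSum_splitPart hself hsymm hsum hh'
    have hle : ∀ A, τ A ≤ s A := by
      intro A
      by_cases hA : free A
      · simpa [τ, hA] using (hs A).1
      · simp only [τ, if_neg hA]
        simp only [free] at hA
        push Not at hA
        obtain ⟨u, v, huv, hiff⟩ := hA
        have e1 := hedge A u v huv
        have e2 := hedge' A u v (hh.2 u v huv)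
        by_cases hu : u ∈ A.1
        · rw [splitExcess_of_mem _ _ hu (hiff.1 hu)] at e1 e2
          linarith
        · rw [splitExcess_of_notMem _ _ hu (mt hiff.2 hu)] at e1 e2
          linarith
    have hpart : ∀ (A : PointedSplit d x) (r : ℝ), splitPart A.1 A.weight r x = r :=
      fun A r => if_pos A.2.2
    have hx : HasSum (fun A => s A - τ A) (h x - g x) := by
      simpa only [hpart] using (hhsum x).sub (hg x)
    have hy := (hg y).sub (hhsum y)
    refine abs_le.2 ⟨?_, ?_⟩
    · refine hasSum_le (fun A => ?_) hx.neg hy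
      have := hle A
      unfold splitPart
      split_ifs <;> linarith
    · refine hasSum_le (fun A => ?_) hy hx
      have := hle A
      unfold splitPart
      split_ifs <;> linarith

end Decomposition

/-! ### The local rank condition: `E(X, d) = E'(X, d)` -/

theorem ExtSet.mem_deltaSet {d : X → X → ℝ} {f : X → ℝ} (hf : f ∈ ExtSet d) : f ∈ DeltaSet d := by
  intro u v
  have := (hf u).1 ⟨v, rfl⟩
  linarith

/-- For integer-valued `d`, the set `E'(X, d)` is dense in `E(X, d)`. -/
theorem exists_mem_extSet'_near {d : X → X → ℝ} (hself : ∀ u, d u u = 0)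
    (hsymm : ∀ u v, d u v = d v u) (hint : IsIntegerValued d) {f : X → ℝ} (hf : f ∈ ExtSet d)
    {ε : ℝ} (hε : 0 < ε) : ∃ g ∈ ExtSet' d, ∀ u, |f u - g u| < ε := by
  classical
  obtain ⟨n, hn⟩ := exists_nat_one_div_lt hε
  set k : ℝ := n + 1 with hk
  have hk0 : 0 < k := by positivity
  choose D hD using hint
  -- the elements of `Δ(X, k d)` with values in `ℕ`, below the rounding of `k f`
  let P : Set (X → ℕ) := {m | ∀ u v, (n + 1 : ℤ) * D u v ≤ m u + m v}
  let m₀ : X → ℕ := fun u => ⌈k * f u⌉₊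
  have hfΔ := ExtSet.mem_deltaSet hf
  have hf0 : ∀ u, 0 ≤ f u := fun u => by
    have := hfΔ u u
    rw [hself] at this
    linarith
  have cast_iff : ∀ (m : X → ℕ) u v,
      (n + 1 : ℤ) * D u v ≤ m u + m v ↔ k * d u v ≤ m u + m v := by
    intro m u v
    rw [hD, hk]
    exact_mod_cast Iff.rfl
  have hm₀ : m₀ ∈ P := by
    intro u v
    rw [cast_iff]
    have h1 := Nat.le_ceil (k * f u)
    have h2 := Nat.le_ceil (k * f v)
    have h3 := mul_le_mul_of_nonneg_left (hfΔ u v) hk0.le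
    simp only [m₀]
    linarith
  obtain ⟨m, hmle, hmP, hmin⟩ : ∃ m ≤ m₀, m ∈ P ∧ ∀ m' ∈ P, m' ≤ m → m' = m := by
    refine (zorn_le_nonempty₀ (α := (X → ℕ)ᵒᵈ) P ?_ m₀ hm₀).elim fun m hm =>
      ⟨m, hm.1, hm.2.1, fun m' hm' hle => le_antisymm hle (hm.2.2 hm' hle)⟩
    · intro c hcP hc m₁ hm₁
      let i : X → ℕ := fun u => sInf ((fun m : X → ℕ => m u) '' c)
      have hi : ∀ u, ∃ m ∈ c, m u = i u := fun u =>
        Nat.sInf_mem (s := (fun m : X → ℕ => m u) '' c) ⟨_, m₁, hm₁, rfl⟩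
      have hile : ∀ m ∈ c, ∀ u, i u ≤ m u := fun m hm u => Nat.sInf_le ⟨m, hm, rfl⟩
      refine ⟨i, fun u v => ?_, hile⟩
      obtain ⟨p, hp, hpu⟩ := hi u
      obtain ⟨q, hq, hqv⟩ := hi v
      rcases hc.total hp hq with hpq | hpq
      · have h1 := hcP hq u v
        have h2 : q u ≤ p u := hpq u
        have h3 : (q u : ℤ) ≤ i u := by exact_mod_cast hpu ▸ h2
        rw [← hqv]
        linarith
      · have h1 := hcP hp u v
        have h2 : p v ≤ q v := hpq v
        have h3 : (p v : ℤ) ≤ i v := by exact_mod_cast hqv ▸ h2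
        rw [← hpu]
        linarith
  have htight : ∀ u, ∃ v, (m u : ℝ) + m v = k * d u v := by
    intro u
    by_contra! hne
    have hmu : m u ≠ 0 := by
      intro h0
      apply hne u
      simp [h0, hself]
    have hlt : ∀ v, (n + 1 : ℤ) * D u v < m u + m v := by
      intro v
      refine lt_of_le_of_ne (hmP u v) fun h => hne v ?_
      rw [hD, hk]
      exact_mod_cast h.symm
    have hDsymm : ∀ u v, D u v = D v u := by
      intro u v
      have := hsymm u v
      rw [hD, hD] at this
      exact_mod_cast this
    have hupd : Function.update m u (m u - 1) ∈ P := by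
      intro v w
      have hDu : D u u = 0 := by
        have := hself u
        rw [hD] at this
        exact_mod_cast this
      rcases eq_or_ne v u with rfl | hv <;> rcases eq_or_ne w v with rfl | hw
      · simp only [Function.update_self, hDu]
        positivity
      · have := hlt w
        rw [Function.update_self, Function.update_of_ne hw]
        push_cast [Nat.one_le_iff_ne_zero.2 hmu]
        linarith
      · rw [Function.update_of_ne hv]
        exact hmP w w
      · rcases eq_or_ne w u with rfl | hw'
        · have := hlt v
          rw [Function.update_self, Function.update_of_ne hv, hDsymm]
          push_cast [Nat.one_le_iff_ne_zero.2 hmu]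
          linarith
        · rw [Function.update_of_ne hv, Function.update_of_ne hw']
          exact hmP v w
    have := congrFun (hmin _ hupd (update_le_self_iff.2 (Nat.sub_le _ _))) u
    rw [Function.update_self] at this
    omega
  refine ⟨fun u => m u / k, ⟨fun u v => ?_, fun u => ?_⟩, fun u => ?_⟩
  · have := (cast_iff m u v).1 (hmP u v)
    rw [← add_div, le_div_iff₀ hk0]
    linarith
  · obtain ⟨v, hv⟩ := htight u
    refine ⟨v, ?_⟩
    rw [← add_div, hv, mul_div_cancel_left₀ _ hk0.ne']
  · have hup : ∀ u, (m u : ℝ) / k < f u + 1 / k := by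
      intro u
      have h1 : (m u : ℝ) ≤ m₀ u := by exact_mod_cast hmle u
      have h2 := Nat.ceil_lt_add_one (mul_nonneg hk0.le (hf0 u))
      rw [div_lt_iff₀ hk0, add_mul, one_div, inv_mul_cancel₀ hk0.ne']
      simp only [m₀] at h1
      linarith
    have hlow : f u ≤ m u / k + 1 / k := by
      refine (hf u).2 ?_
      rintro _ ⟨v, rfl⟩
      have h1 := (cast_iff m u v).1 (hmP u v)
      have h2 : d u v ≤ m u / k + m v / k := by
        rw [← add_div, le_div_iff₀ hk0]
        linarith
      linarith [hup v]
    rw [abs_lt]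
    constructor <;> linarith [hup u]

open Real in
/-- Functions attached to distinct values of `cos (2π g)` are linearly independent in the direction
space of `H(A(g))`. -/
theorem natCast_le_rank_dirSubmodule {d : X → X → ℝ} (hint : IsIntegerValued d) (g : X → ℝ)
    {n : ℕ} (p : Fin n → X) (hinj : Injective fun i => cos (2 * π * g (p i)))
    (hsin : ∀ i, sin (2 * π * g (p i)) ≠ 0) :
    (n : Cardinal) ≤ Module.rank ℝ (dirSubmodule (eqSet d g)) := by
  classical
  have hmem : ∀ c : ℝ, (fun u => if cos (2 * π * g u) = c then sin (2 * π * g u) else 0) ∈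
      dirSubmodule (eqSet d g) := by
    rintro c ⟨u, v⟩ huv
    obtain ⟨m, hm⟩ := hint u v
    have hv : 2 * π * g v = m * (2 * π) - 2 * π * g u := by
      have : g u + g v = m := hm ▸ huv
      linear_combination 2 * π * this
    simp only [hv, cos_int_mul_two_pi_sub, sin_int_mul_two_pi_sub]
    split_ifs <;> simp
  let w : Fin n → dirSubmodule (eqSet d g) := fun i => ⟨_, hmem (cos (2 * π * g (p i)))⟩
  have hw : LinearIndependent ℝ w := by
    rw [Fintype.linearIndependent_iff]
    intro a ha i
    have := congrFun (congrArg Subtype.val ha) (p i)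
    simp only [w, Submodule.coe_sum, Submodule.coe_smul, Finset.sum_apply, Pi.smul_apply,
      smul_eq_mul, Submodule.coe_zero, Pi.zero_apply] at this
    rw [Finset.sum_eq_single i (fun j _ hj => by
      rw [if_neg fun h => hj (hinj h.symm), mul_zero]) (by simp), if_pos rfl] at this
    exact (mul_eq_zero.1 this).resolve_right (hsin i)
  simpa using hw.cardinal_lift_le_rank

open Real in
theorem finite_range_cos_of_LRC {d : X → X → ℝ} (hself : ∀ u, d u u = 0)
    (hsymm : ∀ u v, d u v = d v u) (hint : IsIntegerValued d) (hlrc : LRC d) {f : X → ℝ}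
    (hf : f ∈ ExtSet d) : (range fun u => cos (2 * π * f u)).Finite := by
  obtain ⟨ε, hε, N, hN⟩ := hlrc f hf
  by_contra hinf
  have hinf' : ((range fun u => cos (2 * π * f u)) \ {1, -1}).Infinite :=
    Set.Infinite.sdiff hinf (toFinite _)
  let c : Fin (N + 1) → ℝ := fun i => (hinf'.natEmbedding _ i : ℝ)
  have hcinj : Injective c :=
    Subtype.val_injective.comp ((hinf'.natEmbedding _).injective.comp Fin.val_injective)
  have hc : ∀ i, ∃ u, cos (2 * π * f u) = c i := fun i => (hinf'.natEmbedding _ i).2.1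
  have hc1 : ∀ i, c i ≠ 1 ∧ c i ≠ -1 := fun i => by
    simpa [not_or] using (hinf'.natEmbedding _ i).2.2
  choose p hp using hc
  let U : Set (Fin (N + 1) → ℝ) :=
    {y | (∀ i j, i ≠ j → cos (2 * π * y i) ≠ cos (2 * π * y j)) ∧ ∀ i, sin (2 * π * y i) ≠ 0}
  have hU : IsOpen U := by
    simp only [U, ofPred_and, ofPred_forall]
    refine (isOpen_iInter_of_finite fun i => isOpen_iInter_of_finite fun j =>
      isOpen_iInter_of_finite fun _ => isOpen_ne_fun (by fun_prop) (by fun_prop)).inter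
      (isOpen_iInter_of_finite fun i => isOpen_ne_fun (by fun_prop) (by fun_prop))
  have hfU : (fun i => f (p i)) ∈ U := by
    refine ⟨fun i j hij h => hij (hcinj ?_), fun i h => ?_⟩
    · rwa [hp, hp] at h
    · have hsq := sin_sq_add_cos_sq (2 * π * f (p i))
      rw [h, hp] at hsq
      have : c i * c i = 1 := by linarith
      exact (mul_self_eq_one_iff.1 this).elim (hc1 i).1 (hc1 i).2
  obtain ⟨δ, hδ, hball⟩ := Metric.isOpen_iff.1 hU _ hfU
  obtain ⟨g, hg, hfg⟩ := exists_mem_extSet'_near hself hsymm hint hf (lt_min hε hδ)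
  have hgU : (fun i => g (p i)) ∈ U := hball <| by
    rw [Metric.mem_ball, dist_comm, dist_pi_lt_iff hδ]
    exact fun i => (hfg _).trans_le (min_le_right _ _)
  have h1 := natCast_le_rank_dirSubmodule hint g p
    (fun i j h => by_contra fun hij => hgU.1 i j hij h) hgU.2
  have h2 := hN g hg fun u => (hfg u).trans_le (min_le_left _ _)
  have h3 : N + 1 ≤ N := by exact_mod_cast h1.trans h2
  omega

open Real in
theorem finite_Icc_inter_preimage_cos (a b : ℝ) {C : Set ℝ} (hC : C.Finite) :
    (Icc a b ∩ {z | cos (2 * π * z) ∈ C}).Finite := by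
  have hint : ∀ a b : ℝ, {k : ℤ | a ≤ k ∧ (k : ℝ) ≤ b}.Finite := fun a b =>
    (finite_Icc ⌈a⌉ ⌊b⌋).subset fun k hk => ⟨Int.ceil_le.2 hk.1, Int.le_floor.2 hk.2⟩
  have hone : ∀ c : ℝ, (Icc a b ∩ {z | cos (2 * π * z) = c}).Finite := by
    intro c
    rcases (Icc a b ∩ {z | cos (2 * π * z) = c}).eq_empty_or_nonempty with h | ⟨y, -, hy⟩
    · rw [h]
      exact finite_empty
    refine (((hint (a - y) (b - y)).image fun k : ℤ => k + y).union
      ((hint (a + y) (b + y)).image fun k : ℤ => k - y)).subset ?_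
    rintro z ⟨hz, hzc⟩
    obtain ⟨k, hk⟩ := cos_eq_cos_iff.1 (hy.trans hzc.symm)
    rcases hk with hk | hk
    · have hzk : z = k + y := by
        apply mul_left_cancel₀ two_pi_pos.ne'
        linear_combination hk
      exact Or.inl ⟨k, ⟨by linarith [hz.1], by linarith [hz.2]⟩, hzk.symm⟩
    · have hzk : z = k - y := by
        apply mul_left_cancel₀ two_pi_pos.ne'
        linear_combination hk
      exact Or.inr ⟨k, ⟨by linarith [hz.1], by linarith [hz.2]⟩, hzk.symm⟩
  refine (hC.biUnion fun c _ => hone c).subset ?_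
  rintro z ⟨hz, hzC⟩
  exact mem_biUnion hzC ⟨hz, rfl⟩

open Real in
theorem extSet_subset_extSet' {d : X → X → ℝ} (hself : ∀ u, d u u = 0)
    (hsymm : ∀ u v, d u v = d v u) (hint : IsIntegerValued d) (hlrc : LRC d) {f : X → ℝ}
    (hf : f ∈ ExtSet d) : f ∈ ExtSet' d := by
  refine ⟨ExtSet.mem_deltaSet hf, fun u => ?_⟩
  have hlub := hf u
  set R : Set ℝ := {r | ∃ y, r = d u y - f y}
  have hmem : d u u - f u ∈ R := ⟨u, rfl⟩
  have hlub' := hlub.inter_Ici_of_mem hmem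
  have hfin : (R ∩ Ici (d u u - f u)).Finite := by
    refine (finite_Icc_inter_preimage_cos (d u u - f u) (f u)
      (finite_range_cos_of_LRC hself hsymm hint hlrc hf)).subset ?_
    rintro _ ⟨⟨v, rfl⟩, hv⟩
    refine ⟨⟨hv, hlub.1 ⟨v, rfl⟩⟩, v, ?_⟩
    obtain ⟨n, hn⟩ := hint u v
    have : 2 * π * (d u v - f v) = n * (2 * π) - 2 * π * f v := by
      rw [hn]
      ring
    rw [this, cos_int_mul_two_pi_sub]
  obtain ⟨⟨v, hv⟩, -⟩ := hfin.isClosed.isLUB_mem hlub' ⟨_, hmem, self_mem_Ici⟩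
  exact ⟨v, by linarith⟩

theorem supDist_eq_ofReal {f g : X → ℝ} {x : X} {r : ℝ} (hle : ∀ y, |f y - g y| ≤ r)
    (hx : |f x - g x| = r) : supDist f g = ENNReal.ofReal r := by
  refine le_antisymm (iSup_le fun y => ?_) ?_
  · rw [edist_dist, Real.dist_eq]
    exact ENNReal.ofReal_le_ofReal (hle y)
  · rw [← hx, ← Real.dist_eq, ← edist_dist]
    exact le_iSup (fun i => edist (f i) (g i)) x

theorem supDist_dist_of_mem_extSet' {d : X → X → ℝ} (hd : IsPseudometric d) {h : X → ℝ}
    (hh : h ∈ ExtSet' d) (x : X) : supDist (d x) h = ENNReal.ofReal (h x) := by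
  obtain ⟨hself, hsymm, htri⟩ := hd
  have h0 : 0 ≤ h x := by
    have := hh.1 x x
    rw [hself] at this
    linarith
  refine supDist_eq_ofReal (x := x) (fun y => abs_le.2 ⟨?_, ?_⟩) ?_
  · obtain ⟨z, hz⟩ := hh.2 y
    linarith [htri y x z, hh.1 x z, hsymm x y]
  · linarith [hh.1 x y]
  · rw [hself, zero_sub, abs_neg, abs_of_nonneg h0]

theorem statement16 (d : X → X → ℝ) (hmet : IsMetric d) (hint : IsIntegerValued d)
    (hTSD : TSD d) (hlrc : LRC d) (f : X → ℝ) (hf : f ∈ ExtSet d) (x : X) :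
    ∃ g ∈ cellOf d f, ∀ h ∈ cellOf d f,
      supDist (d x) h = supDist (d x) g + supDist g h := by
  obtain ⟨hself, hsymm, -⟩ := hmet.1
  have hf' := extSet_subset_extSet' hself hsymm hint hlrc hf
  have hcell : ∀ h ∈ cellOf d f, h ∈ ExtSet' d := fun h hh =>
    ⟨hh.1, fun u => (hf'.2 u).imp fun v huv => hh.2 u v huv⟩
  obtain ⟨g, hg, hgate⟩ := exists_gate (x := x) hself hsymm (hTSD.hasSum hmet x) hf'
  refine ⟨g, hg, fun h hh => ?_⟩
  have hle : 0 ≤ h x - g x := (abs_nonneg _).trans (hgate h hh x)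
  have hg0 : 0 ≤ g x := by
    have := hg.1 x x
    rw [hself] at this
    linarith
  rw [supDist_dist_of_mem_extSet' hmet.1 (hcell h hh),
    supDist_dist_of_mem_extSet' hmet.1 (hcell g hg),
    supDist_eq_ofReal (hgate h hh) (by rw [abs_sub_comm, abs_of_nonneg hle]),
    ← ENNReal.ofReal_add hg0 hle, add_sub_cancel]
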